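/- Let (M,d) be a complete metric space, and let A, B be nonempty closed subsets of M such that A₀ = {x ∈ A : ∃ y ∈ B, d(x,y) = dist(A,B)} is nonempty and B is approximatively compact with respect to A. Let T : A → B be a p-proximal contraction with contraction constant k ∈ (0,1) such that T(A₀) ⊆ B₀, where B₀ = {y ∈ B : ∃ x ∈ A, d(x,y) = dist(A,B)}. Then T has a unique best proximity point, i.e., there exists a unique z ∈ A with d(z, T z) = dist(A,B). -/

import Mathlib

open Metric Filter Topology

/-- The distance between two sets: `inf {d(x,y) : x ∈ A, y ∈ B}`. -/
noncomputable def SetDist {M : Type*} [MetricSpace M] (A B : Set M) : ℝ :=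
  sInf {r : ℝ | ∃ x ∈ A, ∃ y ∈ B, r = dist x y}

/-- `A₀ = {x ∈ A : ∃ y ∈ B, d(x,y) = dist(A,B)}`. -/
def SetA0 {M : Type*} [MetricSpace M] (A B : Set M) : Set M :=
  {x ∈ A | ∃ y ∈ B, dist x y = SetDist A B}

/-- `B₀ = {y ∈ B : ∃ x ∈ A, d(x,y) = dist(A,B)}`. -/
def SetB0 {M : Type*} [MetricSpace M] (A B : Set M) : Set M :=
  {y ∈ B | ∃ x ∈ A, dist x y = SetDist A B}

/-- `T : A → B` is a p-proximal contraction with constant `k`. -/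
def IsPProximalContraction {M : Type*} [MetricSpace M] (A B : Set M) (T : M → M) (k : ℝ) : Prop :=
  (∀ x ∈ A, T x ∈ B) ∧
  ∀ u₁ ∈ A, ∀ u₂ ∈ A, ∀ x₁ ∈ A, ∀ x₂ ∈ A,
    dist u₁ (T x₁) = SetDist A B → dist u₂ (T x₂) = SetDist A B →
    dist u₁ u₂ ≤ k * (dist x₁ x₂ + |dist u₁ x₁ - dist u₂ x₂|)

/-- `B` is approximatively compact with respect to `A`: every sequence in `B` with
`d(x, yₙ) → dist(x, B)` for some `x ∈ A` has a convergent subsequence. -/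
def ApproxCompactWRT {M : Type*} [MetricSpace M] (A B : Set M) : Prop :=
  ∀ y : ℕ → M, (∀ n, y n ∈ B) →
    (∃ x ∈ A, Tendsto (fun n => dist x (y n)) atTop (𝓝 (Metric.infDist x B))) →
    ∃ φ : ℕ → ℕ, StrictMono φ ∧ ∃ l : M, Tendsto (y ∘ φ) atTop (𝓝 l)

theorem setDist_le_dist {M : Type*} [MetricSpace M] {A B : Set M} {x y : M}
    (hx : x ∈ A) (hy : y ∈ B) : SetDist A B ≤ dist x y :=
  csInf_le ⟨0, by rintro r ⟨a, _, b, _, rfl⟩; exact dist_nonneg⟩ ⟨x, hx, y, hy, rfl⟩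

/-- Limits of points of `A` whose distance to a sequence in `B` is `dist(A,B)` lie in `A₀`. -/
theorem mem_setA0_of_tendsto {M : Type*} [MetricSpace M] {A B : Set M}
    (hBcl : IsClosed B) (hcomp : ApproxCompactWRT A B) {x y : ℕ → M} {z : M} (hz : z ∈ A)
    (hy : ∀ n, y n ∈ B) (hxy : ∀ n, dist (x n) (y n) = SetDist A B)
    (hx : Tendsto x atTop (𝓝 z)) : z ∈ SetA0 A B := by
  have hlim : Tendsto (fun n => dist z (y n)) atTop (𝓝 (SetDist A B)) := by
    have hupper : Tendsto (fun n => dist z (x n) + SetDist A B) atTop (𝓝 (SetDist A B)) := by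
      simpa using ((tendsto_const_nhds (x := z)).dist hx).add_const (SetDist A B)
    refine tendsto_of_tendsto_of_tendsto_of_le_of_le tendsto_const_nhds hupper
      (fun n => setDist_le_dist hz (hy n)) fun n => ?_
    have := dist_triangle z (x n) (y n)
    rwa [hxy n] at this
  have hinf : infDist z B = SetDist A B :=
    le_antisymm (ge_of_tendsto' hlim fun n => infDist_le_dist_of_mem (hy n))
      ((le_infDist ⟨y 0, hy 0⟩).2 fun _ hb => setDist_le_dist hz hb)
  obtain ⟨φ, hφ, l, hl⟩ := hcomp y hy ⟨z, hz, by rwa [hinf]⟩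
  exact ⟨hz, l, hBcl.mem_of_tendsto hl (Eventually.of_forall fun n => hy (φ n)),
    tendsto_nhds_unique (tendsto_const_nhds.dist hl) (hlim.comp hφ.tendsto_atTop)⟩

/-- Successive distances of a proximal iteration shrink by the factor `2k/(1+k)`. -/
theorem le_two_mul_div_mul_of_le {k a b : ℝ} (hk0 : 0 < k) (hk : k < 1) (ha : 0 ≤ a)
    (h : b ≤ k * (a + |a - b|)) : b ≤ 2 * k / (1 + k) * a := by
  have hba : b ≤ a := by
    by_contra! hab
    rw [abs_of_neg (by linarith)] at h
    nlinarith
  rw [abs_of_nonneg (by linarith)] at h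
  rw [div_mul_eq_mul_div, le_div_iff₀ (by linarith)]
  linarith

theorem best_proximity_point_of_pProximal
    {M : Type*} [MetricSpace M] [CompleteSpace M]
    (A B : Set M) (hA : A.Nonempty) (hB : B.Nonempty)
    (hAcl : IsClosed A) (hBcl : IsClosed B)
    (hA0 : (SetA0 A B).Nonempty)
    (hcomp : ApproxCompactWRT A B)
    (T : M → M) (k : ℝ) (hk0 : 0 < k) (hk : k < 1)
    (hT : IsPProximalContraction A B T k)
    (hTA0 : ∀ x ∈ SetA0 A B, T x ∈ SetB0 A B) :
    ∃! z, z ∈ A ∧ dist z (T z) = SetDist A B := by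
  have hstep : ∀ x : SetA0 A B, ∃ u : SetA0 A B, dist (u : M) (T x) = SetDist A B := by
    rintro ⟨x, hx⟩
    obtain ⟨hB', u, hu, hd⟩ := hTA0 x hx
    exact ⟨⟨u, hu, T x, hB', hd⟩, hd⟩
  choose f hf using hstep
  obtain ⟨x₀, hx₀⟩ := hA0
  let x : ℕ → M := fun n => (f^[n] ⟨x₀, hx₀⟩ : SetA0 A B)
  have hxA : ∀ n, x n ∈ A := fun n => (f^[n] ⟨x₀, hx₀⟩).2.1
  have hx : ∀ n, dist (x (n + 1)) (T (x n)) = SetDist A B := fun n => by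
    simp only [x, Function.iterate_succ_apply']
    exact hf _
  obtain ⟨hTB, hT⟩ := hT
  have hgeom : ∀ n, dist (x n) (x (n + 1)) ≤ dist (x 0) (x 1) * (2 * k / (1 + k)) ^ n := by
    intro n
    induction n with
    | zero => simp
    | succ n ih =>
      have h := hT _ (hxA (n + 1)) _ (hxA (n + 2)) _ (hxA n) _ (hxA (n + 1)) (hx n) (hx (n + 1))
      rw [dist_comm (x (n + 1)) (x n), dist_comm (x (n + 2)) (x (n + 1))] at h
      calc dist (x (n + 1)) (x (n + 2))
          ≤ 2 * k / (1 + k) * dist (x n) (x (n + 1)) :=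
            le_two_mul_div_mul_of_le hk0 hk dist_nonneg h
        _ ≤ 2 * k / (1 + k) * (dist (x 0) (x 1) * (2 * k / (1 + k)) ^ n) := by gcongr
        _ = dist (x 0) (x 1) * (2 * k / (1 + k)) ^ (n + 1) := by ring
  have hr : 2 * k / (1 + k) < 1 := by
    rw [div_lt_one (by linarith)]
    linarith
  obtain ⟨z, hz⟩ := cauchySeq_tendsto_of_complete (cauchySeq_of_le_geometric _ _ hr hgeom)
  have hzA : z ∈ A := hAcl.mem_of_tendsto hz (Eventually.of_forall hxA)
  have hz' : Tendsto (fun n => x (n + 1)) atTop (𝓝 z) := hz.comp (tendsto_add_atTop_nat 1)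
  have hzA0 : z ∈ SetA0 A B :=
    mem_setA0_of_tendsto hBcl hcomp hzA (fun n => hTB _ (hxA n)) hx hz'
  obtain ⟨-, u, hu, hud⟩ := hTA0 z hzA0
  have hle : dist z u ≤ k * (dist z z + |dist z z - dist u z|) :=
    le_of_tendsto_of_tendsto' (hz'.dist tendsto_const_nhds)
      (((hz.dist tendsto_const_nhds).add
        ((hz'.dist hz).sub tendsto_const_nhds).abs).const_mul k)
      fun n => hT _ (hxA (n + 1)) _ hu _ (hxA n) _ hzA (hx n) hud
  have hzu : z = u := by
    rw [dist_self, zero_sub, abs_neg, zero_add, abs_of_nonneg dist_nonneg, dist_comm u z] at hle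
    exact dist_le_zero.1 (by nlinarith)
  refine ⟨z, ⟨hzA, by rwa [← hzu] at hud⟩, ?_⟩
  rintro w ⟨hwA, hw⟩
  rw [← hzu] at hud
  have h := hT _ hwA _ hzA _ hwA _ hzA hw hud
  simp only [dist_self, sub_self, abs_zero, add_zero] at h
  exact dist_le_zero.1 (by nlinarith)
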